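/- arXiv:2303.07659 — 2 statements merged into one kernel-verified Lean document; each statement's English description precedes it below -/
import Mathlib

section
/- Let N = 7. Then there exist constants C > 0 and ε₀ > 0 such that for all ε ∈ (0, ε₀), ∫_{ℝ^7} |∇V_ε(x)|² dx ≥ (9/32) c₇ ω₇ ε − C ε^{3/2}, where c₇ = (7·3·45)^{3/4} = (7(7−4)(7²−4))^{(7−4)/4} and ω₇ is the surface area of the unit sphere in ℝ⁷. -/
open MeasureTheory Real Filter Asymptotics
open scoped Topology

/-- The Euclidean Laplacian: sum of second partial derivatives in the
coordinate directions. -/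
noncomputable def lapl {N : ℕ} (u : EuclideanSpace ℝ (Fin N) → ℝ)
    (x : EuclideanSpace ℝ (Fin N)) : ℝ :=
  ∑ i : Fin N, fderiv ℝ (fun y => fderiv ℝ u y (EuclideanSpace.single i 1)) x
    (EuclideanSpace.single i 1)

/-- The function `u_ε(x) = [N(N−4)(N²−4)ε²]^{(N−4)/8} / (ε + |x|²)^{(N−4)/2}`. -/
noncomputable def bubble (N : ℕ) (ε : ℝ) (x : EuclideanSpace ℝ (Fin N)) : ℝ :=
  ((N : ℝ) * ((N : ℝ) - 4) * ((N : ℝ) ^ 2 - 4) * ε ^ 2) ^ (((N : ℝ) - 4) / 8) /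
    (ε + ‖x‖ ^ 2) ^ (((N : ℝ) - 4) / 2)

/-- The truncated function `V_ε(x) = g(|x|) u_ε(x)`. -/
noncomputable def cutBubble (N : ℕ) (g : ℝ → ℝ) (ε : ℝ)
    (x : EuclideanSpace ℝ (Fin N)) : ℝ :=
  g ‖x‖ * bubble N ε x

/-- The surface area of the unit sphere in `ℝ^N`, i.e. `N` times the volume of
the unit ball. -/
noncomputable def sphereArea (N : ℕ) : ℝ :=
  (N : ℝ) * (volume (Metric.ball (0 : EuclideanSpace ℝ (Fin N)) 1)).toReal

theorem bubble_seven (ε : ℝ) (x : EuclideanSpace ℝ (Fin 7)) :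
    bubble 7 ε x = ((945 : ℝ) * ε ^ 2) ^ ((3 : ℝ) / 8) / (ε + ‖x‖ ^ 2) ^ ((3 : ℝ) / 2) := by
  unfold bubble
  norm_num

theorem contDiff_bubble (N : ℕ) {ε : ℝ} (hε : 0 < ε) : ContDiff ℝ 1 (bubble N ε) := by
  unfold bubble
  have hpos (x : EuclideanSpace ℝ (Fin N)) : 0 < ε + ‖x‖ ^ 2 := by positivity
  refine contDiff_const.div ?_ fun x => (rpow_pos_of_pos (hpos x) _).ne'
  exact (contDiff_const.add (contDiff_norm_sq ℝ)).rpow_const_of_ne fun x => (hpos x).ne'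

theorem cutBubble_eventuallyEq_bubble {N : ℕ} {g : ℝ → ℝ} {ρ : ℝ}
    (hg1 : ∀ r : ℝ, 0 ≤ r → r ≤ ρ → g r = 1) (ε : ℝ) {x : EuclideanSpace ℝ (Fin N)}
    (hx : ‖x‖ < ρ) : cutBubble N g ε =ᶠ[𝓝 x] bubble N ε := by
  filter_upwards [continuous_norm.continuousAt.eventually_lt_const hx] with y hy
  simp [cutBubble, hg1 _ (norm_nonneg y) hy.le]

theorem contDiff_cutBubble (N : ℕ) {g : ℝ → ℝ} (hg : ContDiff ℝ 1 g) {ρ : ℝ} (hρ : 0 < ρ)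
    (hg1 : ∀ r : ℝ, 0 ≤ r → r ≤ ρ → g r = 1) {ε : ℝ} (hε : 0 < ε) :
    ContDiff ℝ 1 (cutBubble N g ε) := by
  rw [contDiff_iff_contDiffAt]
  intro x
  rcases eq_or_ne x 0 with rfl | hx
  · exact (contDiff_bubble N hε).contDiffAt.congr_of_eventuallyEq
      (cutBubble_eventuallyEq_bubble hg1 ε (by simpa using hρ))
  · exact (hg.contDiffAt.comp x (contDiffAt_norm ℝ hx)).mul (contDiff_bubble N hε).contDiffAt

theorem hasCompactSupport_cutBubble (N : ℕ) {g : ℝ → ℝ} {ρ : ℝ}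
    (hg0 : ∀ r : ℝ, 2 * ρ ≤ r → g r = 0) (ε : ℝ) : HasCompactSupport (cutBubble N g ε) := by
  refine HasCompactSupport.intro (isCompact_closedBall 0 (2 * ρ)) fun x hx => ?_
  have : 2 * ρ < ‖x‖ := by simpa using hx
  simp [cutBubble, hg0 _ this.le]

theorem norm_gradient {N : ℕ} (f : EuclideanSpace ℝ (Fin N) → ℝ) (x : EuclideanSpace ℝ (Fin N)) :
    ‖gradient f x‖ = ‖fderiv ℝ f x‖ :=
  LinearIsometryEquiv.norm_map _ _

theorem integrable_norm_gradient_sq {N : ℕ} {f : EuclideanSpace ℝ (Fin N) → ℝ}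
    (hf : ContDiff ℝ 1 f) (hs : HasCompactSupport f) :
    Integrable fun x => ‖gradient f x‖ ^ 2 := by
  simp_rw [norm_gradient]
  refine ((hf.continuous_fderiv one_ne_zero).norm.pow 2).integrable_of_hasCompactSupport ?_
  exact (hs.fderiv ℝ).mono fun x hx h => hx (by simp [h])

theorem norm_gradient_bubble_seven_sq {ε : ℝ} (hε : 0 < ε) (x : EuclideanSpace ℝ (Fin 7)) :
    ‖gradient (bubble 7 ε) x‖ ^ 2 =
      9 * (945 : ℝ) ^ ((3 : ℝ) / 4) * ε ^ ((3 : ℝ) / 2) * (‖x‖ ^ 2 / (ε + ‖x‖ ^ 2) ^ 5) := by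
  set K : ℝ := ((945 : ℝ) * ε ^ 2) ^ ((3 : ℝ) / 8) with hK
  have hpos : 0 < ε + ‖x‖ ^ 2 := by positivity
  have hK2 : K ^ 2 = (945 : ℝ) ^ ((3 : ℝ) / 4) * ε ^ ((3 : ℝ) / 2) := by
    rw [hK, ← rpow_mul_natCast (by positivity), mul_rpow (by positivity) (by positivity),
      ← rpow_natCast_mul hε.le]
    norm_num
  have hfun : bubble 7 ε = fun y => K * (ε + ‖y‖ ^ 2) ^ (-(3 : ℝ) / 2) := by
    funext y
    rw [bubble_seven, neg_div, rpow_neg (by positivity), div_eq_mul_inv]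
  have hd : HasFDerivAt (bubble 7 ε)
      ((K * (-3 * (ε + ‖x‖ ^ 2) ^ (-(5 : ℝ) / 2))) • innerSL ℝ x) x := by
    rw [hfun]
    have h := ((((hasStrictFDerivAt_norm_sq x).hasFDerivAt.const_add ε).rpow_const
      (p := -(3 : ℝ) / 2) (Or.inl hpos.ne')).const_mul K)
    refine h.congr_fderiv ?_
    ext v
    norm_num
    ring
  have hpow : ((ε + ‖x‖ ^ 2) ^ (-(5 : ℝ) / 2)) ^ 2 = ((ε + ‖x‖ ^ 2) ^ 5)⁻¹ := by
    rw [← rpow_mul_natCast hpos.le, ← rpow_natCast _ 5, ← rpow_neg hpos.le]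
    norm_num
  rw [norm_gradient, hd.fderiv, norm_smul, innerSL_apply_norm, mul_pow, Real.norm_eq_abs, sq_abs,
    mul_pow, mul_pow, hpow, hK2]
  ring

theorem div_pow_five_le_of_mul_ge {a t T : ℝ} (ha : 0 < a) (ht : 0 < t) (htT : t ≤ T)
    (h : a ^ 2 ≤ t * T) : T / (a + T) ^ 5 ≤ t / (a + t) ^ 5 := by
  have hT : 0 < T := ht.trans_le htT
  rw [div_le_div_iff₀ (by positivity) (by positivity)]
  have h2 : T * (a + t) ^ 2 ≤ t * (a + T) ^ 2 := by
    nlinarith [mul_nonneg (sub_nonneg.2 htT) (sub_nonneg.2 h)]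
  have h3 : (a + t) ^ 3 ≤ (a + T) ^ 3 := by gcongr
  calc T * (a + t) ^ 5 = T * (a + t) ^ 2 * (a + t) ^ 3 := by ring
    _ ≤ t * (a + T) ^ 2 * (a + T) ^ 3 := by gcongr
    _ = t * (a + T) ^ 5 := by ring

theorem measureReal_ball_diff_ball {N : ℕ} {r s : ℝ} (hr : 0 < r) (hrs : r ≤ s) :
    volume.real (Metric.ball (0 : EuclideanSpace ℝ (Fin N)) s \ Metric.ball 0 r) =
      (s ^ N - r ^ N) * volume.real (Metric.ball (0 : EuclideanSpace ℝ (Fin N)) 1) := by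
  have hs : 0 < s := hr.trans_le hrs
  rw [measureReal_sdiff (Metric.ball_subset_ball hrs) measurableSet_ball]
  simp only [Measure.real]
  rw [Measure.addHaar_ball_of_pos _ _ hr, Measure.addHaar_ball_of_pos _ _ hs]
  simp only [finrank_euclideanSpace, Fintype.card_fin, ENNReal.toReal_mul]
  rw [ENNReal.toReal_ofReal (by positivity), ENNReal.toReal_ofReal (by positivity)]
  ring

/-- The integral of `|∇V_ε|²` over a shell `r ≤ |x| < s` with `ε ≤ r²` and `s ≤ ρ` is at least the
value of `|∇u_ε|²` at the outer radius times the volume of the shell. -/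
theorem le_setIntegral_norm_gradient_cutBubble_sq {g : ℝ → ℝ} (hg : ContDiff ℝ 1 g) {ρ : ℝ}
    (hρ : 0 < ρ) (hg1 : ∀ r : ℝ, 0 ≤ r → r ≤ ρ → g r = 1) (hg0 : ∀ r : ℝ, 2 * ρ ≤ r → g r = 0)
    {ε r s : ℝ} (hε : 0 < ε) (hr : 0 < r) (hrε : ε ≤ r ^ 2) (hrs : r ≤ s) (hs : s ≤ ρ) :
    9 * (945 : ℝ) ^ ((3 : ℝ) / 4) * ε ^ ((3 : ℝ) / 2) * (s ^ 2 / (ε + s ^ 2) ^ 5) *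
        ((s ^ 7 - r ^ 7) * volume.real (Metric.ball (0 : EuclideanSpace ℝ (Fin 7)) 1)) ≤
      ∫ x in Metric.ball (0 : EuclideanSpace ℝ (Fin 7)) s \ Metric.ball 0 r,
        ‖gradient (cutBubble 7 g ε) x‖ ^ 2 := by
  have hint := integrable_norm_gradient_sq (contDiff_cutBubble 7 hg hρ hg1 hε)
    (hasCompactSupport_cutBubble 7 hg0 ε)
  rw [← measureReal_ball_diff_ball hr hrs]
  refine setIntegral_ge_of_const_le_real (measurableSet_ball.diff measurableSet_ball)
    ((measure_mono Set.sdiff_subset).trans_lt measure_ball_lt_top).ne (fun x hx => ?_)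
    hint.integrableOn
  have hxs : ‖x‖ < s := by simpa using hx.1
  have hrx : r ≤ ‖x‖ := by simpa using hx.2
  have hgrad : gradient (cutBubble 7 g ε) x = gradient (bubble 7 ε) x :=
    (cutBubble_eventuallyEq_bubble hg1 ε (hxs.trans_le hs)).gradient_eq
  rw [hgrad, norm_gradient_bubble_seven_sq hε]
  have hx0 : 0 < ‖x‖ := hr.trans_le hrx
  have h1 : ε ≤ ‖x‖ ^ 2 := hrε.trans (by gcongr)
  have h2 : ‖x‖ ^ 2 ≤ s ^ 2 := by gcongr
  refine mul_le_mul_of_nonneg_left ?_ (by positivity)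
  exact div_pow_five_le_of_mul_ge hε (by positivity) h2 (by nlinarith)

/-- For `N = 7`: there are `C > 0` and `ε₀ > 0` such that for `0 < ε < ε₀`,
`∫ |∇V_ε|² ≥ (9/32) c₇ ω₇ ε − C ε^{3/2}`, where
`c₇ = (7(7−4)(7²−4))^{(7−4)/4}` and `ω₇` is the area of the unit sphere in `ℝ⁷`. -/
theorem cutBubble_gradient_lower_bound_dim7 (ρ : ℝ) (hρ : 0 < ρ)
    (g : ℝ → ℝ) (hg : ContDiff ℝ (⊤ : ℕ∞) g)
    (hg01 : ∀ r : ℝ, 0 ≤ r → g r ∈ Set.Icc (0 : ℝ) 1)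
    (hg1 : ∀ r : ℝ, 0 ≤ r → r ≤ ρ → g r = 1)
    (hg0 : ∀ r : ℝ, 2 * ρ ≤ r → g r = 0)
    (c₇ : ℝ)
    (hc₇ : c₇ = ((7 : ℝ) * ((7 : ℝ) - 4) * ((7 : ℝ) ^ 2 - 4)) ^ (((7 : ℝ) - 4) / 4)) :
    ∃ C : ℝ, 0 < C ∧ ∃ ε₀ : ℝ, 0 < ε₀ ∧ ∀ ε : ℝ, 0 < ε → ε < ε₀ →
      (9 / 32) * c₇ * sphereArea 7 * ε - C * ε ^ ((3 : ℝ) / 2)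
        ≤ ∫ x : EuclideanSpace ℝ (Fin 7), ‖gradient (cutBubble 7 g ε) x‖ ^ 2 := by
  have hg' : ContDiff ℝ 1 g := hg.of_le (by exact_mod_cast le_top)
  have hc : c₇ = (945 : ℝ) ^ ((3 : ℝ) / 4) := by rw [hc₇]; norm_num
  refine ⟨1, one_pos, (ρ / 4) ^ 2, by positivity, fun ε hε hε₀ => ?_⟩
  obtain ⟨R, hR, rfl⟩ : ∃ R : ℝ, 0 < R ∧ ε = R ^ 2 := ⟨√ε, sqrt_pos.2 hε, (sq_sqrt hε.le).symm⟩
  have hRρ : R < ρ / 4 := lt_of_pow_lt_pow_left₀ 2 (by positivity) hε₀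
  have hint := integrable_norm_gradient_sq (contDiff_cutBubble 7 hg' hρ hg1 hε)
    (hasCompactSupport_cutBubble 7 hg0 (R ^ 2))
  have hinner := le_setIntegral_norm_gradient_cutBubble_sq hg' hρ hg1 hg0 hε hR le_rfl
    (by linarith : R ≤ 2 * R) (by linarith)
  have houter := le_setIntegral_norm_gradient_cutBubble_sq hg' hρ hg1 hg0 hε
    (by positivity : 0 < 2 * R) (by nlinarith) (by linarith : 2 * R ≤ 4 * R) (by linarith)
  have hdisj : Disjoint (Metric.ball (0 : EuclideanSpace ℝ (Fin 7)) (2 * R) \ Metric.ball 0 R)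
      (Metric.ball 0 (4 * R) \ Metric.ball 0 (2 * R)) :=
    Set.disjoint_sdiff_right.mono_left Set.sdiff_subset
  have hunion := setIntegral_union hdisj (measurableSet_ball.diff measurableSet_ball)
    hint.integrableOn hint.integrableOn
  have hle := setIntegral_le_integral
    (s := (Metric.ball (0 : EuclideanSpace ℝ (Fin 7)) (2 * R) \ Metric.ball 0 R) ∪
      (Metric.ball 0 (4 * R) \ Metric.ball 0 (2 * R)))
    hint (Eventually.of_forall fun x => sq_nonneg _)
  rw [hunion] at hle
  have hpow : (R ^ 2) ^ ((3 : ℝ) / 2) = R ^ 3 := by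
    rw [← rpow_natCast_mul hR.le, ← rpow_natCast]
    norm_num
  rw [hpow, ← hc] at hinner houter
  have hvol : sphereArea 7 = 7 * volume.real (Metric.ball (0 : EuclideanSpace ℝ (Fin 7)) 1) := by
    simp [sphereArea, Measure.real]
  rw [hpow, hvol]
  set v := volume.real (Metric.ball (0 : EuclideanSpace ℝ (Fin 7)) 1)
  have hcv : 0 ≤ c₇ * v * R ^ 2 := by
    have : 0 ≤ c₇ := hc ▸ by positivity
    positivity
  have hR3 : 0 < R ^ 3 := by positivity
  have hin : 9 * c₇ * R ^ 3 * ((2 * R) ^ 2 / (R ^ 2 + (2 * R) ^ 2) ^ 5) *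
      (((2 * R) ^ 7 - R ^ 7) * v) = 9 * (4 * 127 / 5 ^ 5) * (c₇ * v * R ^ 2) := by
    field_simp
    ring
  have hout : 9 * c₇ * R ^ 3 * ((4 * R) ^ 2 / (R ^ 2 + (4 * R) ^ 2) ^ 5) *
      (((4 * R) ^ 7 - (2 * R) ^ 7) * v) = 9 * (16 * 16256 / 17 ^ 5) * (c₇ * v * R ^ 2) := by
    field_simp
    ring
  rw [hin] at hinner
  rw [hout] at houter
  linarith
end

section
/- Let N = 8. Then there exist constants C > 0 and ε₀ > 0 such that for all ε ∈ (0, ε₀), ∫_{ℝ^8} V_ε(x)² log(V_ε(x)²) dx ≤ c₈ ω₈ log( √c₈ e^{25/6} (ε+4ρ²) / (ε+ρ²)² ) · ε² log(1/ε) + C ε², where c₈ = (8(8−4)(8²−4))^{(8−4)/4} and ω₈ is the surface area of the unit sphere in ℝ⁸. -/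
open MeasureTheory Real Filter Asymptotics
open scoped Topology

lemma sq_cutBubble_eight (g : ℝ → ℝ) {ε : ℝ} (hε : 0 < ε) (x : EuclideanSpace ℝ (Fin 8)) :
    (cutBubble 8 g ε x) ^ 2 = g ‖x‖ ^ 2 * (1920 * ε ^ 2 / (ε + ‖x‖ ^ 2) ^ 4) := by
  have hexp : (((8 : ℕ) : ℝ) - 4) / 8 = 1 / 2 := by norm_num
  have hexp' : (((8 : ℕ) : ℝ) - 4) / 2 = (2 : ℕ) := by norm_num
  have hbase : ((8 : ℕ) : ℝ) * (((8 : ℕ) : ℝ) - 4) * (((8 : ℕ) : ℝ) ^ 2 - 4) * ε ^ 2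
      = 1920 * ε ^ 2 := by norm_num
  rw [cutBubble, bubble, hexp, hexp', hbase, Real.rpow_natCast, ← Real.sqrt_eq_rpow, mul_pow,
    div_pow, Real.sq_sqrt (by positivity), ← pow_mul]

/-- Pointwise comparison of the radial integrand of `u_ε² log u_ε²` with an exact derivative. -/
lemma pow_seven_mul_log_le {c ε y M : ℝ} (hc : 0 < c) (hε : 0 < ε) (hy : 0 ≤ y)
    (hM : 0 ≤ M) (hM' : 2 * log (1 / ε) + 4 * log (ε + y ^ 2) - log c ≤ M) :
    y ^ 7 * (c * ε ^ 2 / (ε + y ^ 2) ^ 4 * log (c * ε ^ 2 / (ε + y ^ 2) ^ 4)) ≤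
      c * ε ^ 2 * (y * ((log c - 2 * log (1 / ε) - 4 * log (ε + y ^ 2)) / (ε + y ^ 2)
        + 3 * ε * M / (ε + y ^ 2) ^ 2)) := by
  have ht : 0 < ε + y ^ 2 := by positivity
  have hlog : log (c * ε ^ 2 / (ε + y ^ 2) ^ 4)
      = log c - 2 * log (1 / ε) - 4 * log (ε + y ^ 2) := by
    rw [log_div (by positivity) (by positivity), log_mul (by positivity) (by positivity),
      log_pow, log_pow, one_div, log_inv]
    push_cast
    ring
  rw [hlog]
  set h := log c - 2 * log (1 / ε) - 4 * log (ε + y ^ 2) with hh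
  have hhM : -h ≤ M := by rw [hh]; linarith
  have hdef : 0 ≤ (ε + y ^ 2) ^ 3 - (y ^ 2) ^ 3 := by
    have : (y ^ 2) ^ 3 ≤ (ε + y ^ 2) ^ 3 := by gcongr; linarith
    linarith
  have hdef' : (ε + y ^ 2) ^ 3 - (y ^ 2) ^ 3 ≤ 3 * ε * (ε + y ^ 2) ^ 2 := by
    have : 0 ≤ 2 * ε ^ 3 + 3 * ε ^ 2 * y ^ 2 := by positivity
    nlinarith
  have key : ((ε + y ^ 2) ^ 3 - (y ^ 2) ^ 3) * (-h) ≤ 3 * ε * (ε + y ^ 2) ^ 2 * M :=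
    (mul_le_mul_of_nonneg_left hhM hdef).trans (mul_le_mul_of_nonneg_right hdef' hM)
  have hdiff : c * ε ^ 2 * (y * (h / (ε + y ^ 2) + 3 * ε * M / (ε + y ^ 2) ^ 2))
      - y ^ 7 * (c * ε ^ 2 / (ε + y ^ 2) ^ 4 * h)
      = c * ε ^ 2 * y / (ε + y ^ 2) ^ 4 * (3 * ε * (ε + y ^ 2) ^ 2 * M
        - ((ε + y ^ 2) ^ 3 - (y ^ 2) ^ 3) * (-h)) := by
    field_simp
    ring
  have : 0 ≤ c * ε ^ 2 * y / (ε + y ^ 2) ^ 4 * (3 * ε * (ε + y ^ 2) ^ 2 * M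
        - ((ε + y ^ 2) ^ 3 - (y ^ 2) ^ 3) * (-h)) :=
    mul_nonneg (by positivity) (by linarith)
  linarith

lemma integral_radial_majorant {ε : ℝ} (hε : 0 < ε) (k M ρ : ℝ) :
    ∫ y in (0 : ℝ)..ρ, y * ((k - 4 * log (ε + y ^ 2)) / (ε + y ^ 2)
        + 3 * ε * M / (ε + y ^ 2) ^ 2) =
      (k * (log (ε + ρ ^ 2) - log ε) - 2 * (log (ε + ρ ^ 2) ^ 2 - log ε ^ 2)
        + 3 * M * (1 - ε / (ε + ρ ^ 2))) / 2 := by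
  have hpos : ∀ y : ℝ, ε + y ^ 2 ≠ 0 := fun y => by positivity
  have hderiv : ∀ y ∈ Set.uIcc (0 : ℝ) ρ, HasDerivAt
      (fun y : ℝ => (k * log (ε + y ^ 2) - 2 * log (ε + y ^ 2) ^ 2
        - 3 * ε * M * (ε + y ^ 2)⁻¹) / 2)
      (y * ((k - 4 * log (ε + y ^ 2)) / (ε + y ^ 2) + 3 * ε * M / (ε + y ^ 2) ^ 2)) y := by
    intro y _
    have ht : HasDerivAt (fun y : ℝ => ε + y ^ 2) (2 * y) y := by
      simpa using (hasDerivAt_pow 2 y).const_add ε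
    have hl := ht.log (hpos y)
    have hy := hpos y
    refine ((((hl.const_mul k).sub ((hl.pow 2).const_mul 2)).sub
      ((ht.inv (hpos y)).const_mul (3 * ε * M))).div_const 2).congr_deriv ?_
    field_simp
    ring
  rw [intervalIntegral.integral_eq_sub_of_hasDerivAt hderiv]
  · have := hpos ρ
    simp only [ne_eq, OfNat.ofNat_ne_zero, not_false_eq_true, zero_pow, add_zero]
    field_simp
    ring
  · apply Continuous.intervalIntegrable
    fun_prop (disch := exact fun _ => by positivity)

/-- Radial upper bound on the ball where the cut-off is identically `1`. -/
lemma integral_pow_seven_mul_log_le {c ε ρ B : ℝ} (hc : 1 ≤ c) (hε : 0 < ε) (hε1 : ε < 1)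
    (hρ : 0 < ρ) (hB : B = log (1 + ρ ^ 2)) :
    ∫ y in (0 : ℝ)..ρ, y ^ 7 * (c * ε ^ 2 / (ε + y ^ 2) ^ 4
        * log (c * ε ^ 2 / (ε + y ^ 2) ^ 4)) ≤
      c * ε ^ 2 * ((log c / 2 - log (ε + ρ ^ 2) + 3) * log (1 / ε)
        + (log c * B / 2 + 6 * B)) := by
  have hc0 : 0 < c := by linarith
  have hlc : 0 ≤ log c := log_nonneg hc
  have hB0 : 0 ≤ B := hB ▸ log_nonneg (by nlinarith [sq_nonneg ρ])
  have hL : log (1 / ε) = -log ε := by rw [one_div, log_inv]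
  have hL0 : 0 ≤ log (1 / ε) := by rw [hL]; linarith [log_neg hε hε1]
  have haB : log (ε + ρ ^ 2) ≤ B := hB ▸ log_le_log (by positivity) (by linarith)
  have hM0 : 0 ≤ 2 * log (1 / ε) + 4 * B := by positivity
  refine (intervalIntegral.integral_mono_on (g := fun y => c * ε ^ 2 *
    (y * ((log c - 2 * log (1 / ε) - 4 * log (ε + y ^ 2)) / (ε + y ^ 2)
        + 3 * ε * (2 * log (1 / ε) + 4 * B) / (ε + y ^ 2) ^ 2))) hρ.le ?_ ?_ ?_).trans ?_
  · apply Continuous.intervalIntegrable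
    fun_prop (disch := exact fun _ => by positivity)
  · apply Continuous.intervalIntegrable
    fun_prop (disch := exact fun _ => by positivity)
  · intro y hy
    refine pow_seven_mul_log_le hc0 hε hy.1 hM0 ?_
    have : log (ε + y ^ 2) ≤ log (ε + ρ ^ 2) :=
      log_le_log (by have := hy.1; positivity) (by have := hy.1; have := hy.2; gcongr)
    linarith
  · rw [intervalIntegral.integral_const_mul, integral_radial_majorant hε, hL]
    rw [hL] at hL0 hM0
    refine mul_le_mul_of_nonneg_left ?_ (by positivity)
    have h1 : 0 ≤ (2 * -log ε + 4 * B) * (ε / (ε + ρ ^ 2)) := by positivity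
    have h2 : log c * log (ε + ρ ^ 2) ≤ log c * B := mul_le_mul_of_nonneg_left haB hlc
    nlinarith [sq_nonneg (log (ε + ρ ^ 2))]

/-- Since the integrand is nonpositive for `y ≥ ρ`, the radial integral is at most its part over
`[0, ρ]`, where the cut-off is `1`. -/
lemma integral_cutoff_le {c ε ρ : ℝ} (hc : 0 < c) (hε : 0 < ε) (hρ : 0 < ρ)
    (hsmall : c * ε ^ 2 ≤ ρ ^ 8) {g : ℝ → ℝ} (hg : Continuous g)
    (hg01 : ∀ r : ℝ, 0 ≤ r → g r ∈ Set.Icc (0 : ℝ) 1)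
    (hg1 : ∀ r : ℝ, 0 ≤ r → r ≤ ρ → g r = 1)
    (hg0 : ∀ r : ℝ, 2 * ρ ≤ r → g r = 0) :
    ∫ y in Set.Ioi (0 : ℝ), y ^ 7 * (g y ^ 2 * (c * ε ^ 2 / (ε + y ^ 2) ^ 4)
        * log (g y ^ 2 * (c * ε ^ 2 / (ε + y ^ 2) ^ 4))) ≤
      ∫ y in (0 : ℝ)..ρ, y ^ 7 * (c * ε ^ 2 / (ε + y ^ 2) ^ 4
        * log (c * ε ^ 2 / (ε + y ^ 2) ^ 4)) := by
  have hw : Continuous fun y : ℝ => g y ^ 2 * (c * ε ^ 2 / (ε + y ^ 2) ^ 4) := by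
    fun_prop (disch := exact fun _ => by positivity)
  have hcont : Continuous fun y : ℝ => y ^ 7 * (g y ^ 2 * (c * ε ^ 2 / (ε + y ^ 2) ^ 4)
        * log (g y ^ 2 * (c * ε ^ 2 / (ε + y ^ 2) ^ 4))) :=
    (continuous_pow 7).mul (continuous_mul_log.comp hw)
  have hsupp := setIntegral_eq_of_subset_of_forall_sdiff_eq_zero (μ := volume)
    (f := fun y : ℝ => y ^ 7 * (g y ^ 2 * (c * ε ^ 2 / (ε + y ^ 2) ^ 4)
        * log (g y ^ 2 * (c * ε ^ 2 / (ε + y ^ 2) ^ 4))))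
    (s := Set.Ioc 0 (2 * ρ)) (t := Set.Ioi 0) measurableSet_Ioi
    Set.Ioc_subset_Ioi_self (by
      intro y hy
      have : 2 * ρ ≤ y := by
        by_contra! h
        exact hy.2 ⟨hy.1, h.le⟩
      simp [hg0 y this])
  rw [hsupp, ← intervalIntegral.integral_of_le (by positivity),
    ← intervalIntegral.integral_add_adjacent_intervals
      (hcont.intervalIntegrable 0 ρ) (hcont.intervalIntegrable ρ (2 * ρ))]
  have hinner : ∫ y in (0 : ℝ)..ρ, y ^ 7 * (g y ^ 2 * (c * ε ^ 2 / (ε + y ^ 2) ^ 4)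
        * log (g y ^ 2 * (c * ε ^ 2 / (ε + y ^ 2) ^ 4))) =
      ∫ y in (0 : ℝ)..ρ, y ^ 7 * (c * ε ^ 2 / (ε + y ^ 2) ^ 4
        * log (c * ε ^ 2 / (ε + y ^ 2) ^ 4)) := by
    refine intervalIntegral.integral_congr fun y hy => ?_
    rw [Set.uIcc_of_le hρ.le] at hy
    simp [hg1 y hy.1 hy.2]
  have houter : ∫ y in ρ..(2 * ρ), y ^ 7 * (g y ^ 2 * (c * ε ^ 2 / (ε + y ^ 2) ^ 4)
        * log (g y ^ 2 * (c * ε ^ 2 / (ε + y ^ 2) ^ 4))) ≤ 0 := by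
    rw [intervalIntegral.integral_of_le (by linarith)]
    refine setIntegral_nonpos measurableSet_Ioc fun y hy => ?_
    have hy0 : 0 ≤ y := hρ.le.trans hy.1.le
    obtain ⟨h0, h1⟩ := hg01 y hy0
    have hu : c * ε ^ 2 / (ε + y ^ 2) ^ 4 ≤ 1 := by
      rw [div_le_one (by positivity)]
      calc c * ε ^ 2 ≤ ρ ^ 8 := hsmall
        _ = (ρ ^ 2) ^ 4 := by ring
        _ ≤ (ε + y ^ 2) ^ 4 := by
          have : ρ ^ 2 ≤ y ^ 2 := by have := hy.1.le; gcongr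
          gcongr
          linarith
    have hv : g y ^ 2 * (c * ε ^ 2 / (ε + y ^ 2) ^ 4) ≤ 1 :=
      mul_le_one₀ (pow_le_one₀ h0 h1) (by positivity) hu
    exact mul_nonpos_of_nonneg_of_nonpos (by positivity)
      (mul_nonpos_of_nonneg_of_nonpos (by positivity) (log_nonpos (by positivity) hv))
  linarith

/-- For `N = 8`: there are `C > 0` and `ε₀ > 0` such that for `0 < ε < ε₀`,
`∫ V_ε² log(V_ε²) ≤ c₈ ω₈ log(√c₈ e^{25/6} (ε+4ρ²) / (ε+ρ²)²) ε² log(1/ε) + C ε²`,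
where `c₈ = (8(8−4)(8²−4))^{(8−4)/4}` and `ω₈` is the area of the unit sphere in `ℝ⁸`.
(Here `Real.log 0 = 0`, so the integrand is `0` wherever `V_ε = 0`.) -/
theorem cutBubble_log_upper_bound_dim8 (ρ : ℝ) (hρ : 0 < ρ)
    (g : ℝ → ℝ) (hg : ContDiff ℝ (⊤ : ℕ∞) g)
    (hg01 : ∀ r : ℝ, 0 ≤ r → g r ∈ Set.Icc (0 : ℝ) 1)
    (hg1 : ∀ r : ℝ, 0 ≤ r → r ≤ ρ → g r = 1)
    (hg0 : ∀ r : ℝ, 2 * ρ ≤ r → g r = 0)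
    (c₈ : ℝ)
    (hc₈ : c₈ = ((8 : ℝ) * ((8 : ℝ) - 4) * ((8 : ℝ) ^ 2 - 4)) ^ (((8 : ℝ) - 4) / 4)) :
    ∃ C : ℝ, 0 < C ∧ ∃ ε₀ : ℝ, 0 < ε₀ ∧ ∀ ε : ℝ, 0 < ε → ε < ε₀ →
      (∫ x : EuclideanSpace ℝ (Fin 8),
          (cutBubble 8 g ε x) ^ 2 * Real.log ((cutBubble 8 g ε x) ^ 2))
        ≤ c₈ * sphereArea 8
            * Real.log (Real.sqrt c₈ * Real.exp (25 / 6) * (ε + 4 * ρ ^ 2)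
                / (ε + ρ ^ 2) ^ 2)
            * ε ^ 2 * Real.log (1 / ε) + C * ε ^ 2 := by
  have hc : c₈ = 1920 := by rw [hc₈]; norm_num
  subst hc
  clear hc₈
  have hS : 0 ≤ sphereArea 8 := by unfold sphereArea; positivity
  have hlc : 0 ≤ log (1920 : ℝ) := log_nonneg (by norm_num)
  have hB : 0 ≤ log (1 + ρ ^ 2) := log_nonneg (by nlinarith [sq_nonneg ρ])
  refine ⟨1920 * sphereArea 8 * (log 1920 * log (1 + ρ ^ 2) / 2 + 6 * log (1 + ρ ^ 2)) + 1,
    by positivity, min 1 (ρ ^ 4 / 1920), by positivity, fun ε hε hεlt => ?_⟩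
  obtain ⟨hε1, hερ⟩ := lt_min_iff.mp hεlt
  have hsmall : 1920 * ε ^ 2 ≤ ρ ^ 8 := by
    have : ε ^ 2 ≤ (ρ ^ 4 / 1920) ^ 2 := by gcongr
    have h8 : (ρ ^ 4 / 1920) ^ 2 = ρ ^ 8 / 1920 ^ 2 := by ring
    have : 0 < ρ ^ 8 := by positivity
    linarith
  have hpolar := integral_fun_norm_addHaar (volume : Measure (EuclideanSpace ℝ (Fin 8)))
    (fun r : ℝ => g r ^ 2 * (1920 * ε ^ 2 / (ε + r ^ 2) ^ 4)
      * log (g r ^ 2 * (1920 * ε ^ 2 / (ε + r ^ 2) ^ 4)))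
  simp only [finrank_euclideanSpace, Fintype.card_fin, nsmul_eq_mul, smul_eq_mul,
    Nat.add_one_sub_one] at hpolar
  simp only [sq_cutBubble_eight g hε]
  rw [hpolar, ← mul_assoc]
  change sphereArea 8 * _ ≤ _
  have hL0 : 0 ≤ log (1 / ε) := log_nonneg (by rw [le_div_iff₀ hε]; linarith)
  have hrad := (integral_cutoff_le (by norm_num) hε hρ hsmall hg.continuous hg01 hg1 hg0).trans
    (integral_pow_seven_mul_log_le (by norm_num) hε hε1 hρ rfl)
  have hlog : log (√1920 * exp (25 / 6) * (ε + 4 * ρ ^ 2) / (ε + ρ ^ 2) ^ 2)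
      = log 1920 / 2 + 25 / 6 + log (ε + 4 * ρ ^ 2) - 2 * log (ε + ρ ^ 2) := by
    rw [log_div (by positivity) (by positivity), log_mul (by positivity) (by positivity),
      log_mul (by positivity) (by positivity), log_exp, log_sqrt (by norm_num), log_pow]
    norm_num
  have hmono : log (ε + ρ ^ 2) ≤ log (ε + 4 * ρ ^ 2) :=
    log_le_log (by positivity) (by nlinarith [sq_nonneg ρ])
  have hcoef : (log 1920 / 2 - log (ε + ρ ^ 2) + 3) * log (1 / ε) ≤
      (log 1920 / 2 + 25 / 6 + log (ε + 4 * ρ ^ 2) - 2 * log (ε + ρ ^ 2)) * log (1 / ε) :=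
    mul_le_mul_of_nonneg_right (by linarith) hL0
  rw [hlog]
  have hscale := mul_le_mul_of_nonneg_left hcoef (by positivity : 0 ≤ 1920 * sphereArea 8 * ε ^ 2)
  calc _ ≤ sphereArea 8 * _ := mul_le_mul_of_nonneg_left hrad hS
    _ ≤ _ := by linarith [sq_nonneg ε]
end
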